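/- arXiv:2408.06243 — 4 statements merged into one kernel-verified Lean document; each statement's English description precedes it below -/
import Mathlib

section
/- Let g ∈ ℝⁿ with g ≠ 0, let B be a symmetric n×n real matrix, let Δ > 0, α ≤ 1, β ≤ 1 and 0 < κ_mdc ≤ 1/2. Set r := (‖g‖^α/(1+‖B‖)^β)·Δ, define the quadratic model m(s) := gᵀs + (1/2) sᵀ B s, and let s_cp := −t* g where t* minimizes m(−t g) over t ≥ 0 subject to t‖g‖ ≤ r. Then every s ∈ ℝⁿ satisfying the sufficient-decrease condition m(0) − m(s) ≥ 2 κ_mdc (m(0) − m(s_cp)) also satisfies m(0) − m(s) ≥ κ_mdc ‖g‖ · min{ ‖g‖/(1+‖B‖), r }. -/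
open scoped RealInnerProductSpace

/-- The decrease of a quadratic model along `-g`, at distance `d` from the origin not exceeding
`‖g‖ / (1 + ‖B‖)`, is at least `‖g‖ * d / 2`. -/
theorem half_norm_mul_le_steepest_descent_decrease {E : Type*} [NormedAddCommGroup E]
    [InnerProductSpace ℝ E] {g : E} (hg : g ≠ 0) (B : E →L[ℝ] E) {d : ℝ} (hd : 0 ≤ d)
    (hdB : d ≤ ‖g‖ / (1 + ‖B‖)) :
    ⟪g, -((d / ‖g‖) • g)⟫ + 1 / 2 * ⟪-((d / ‖g‖) • g), B (-((d / ‖g‖) • g))⟫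
      ≤ -(‖g‖ * d / 2) := by
  have hN : 0 < ‖g‖ := norm_pos_iff.mpr hg
  have hb : 0 ≤ ‖B‖ := norm_nonneg B
  have hlin : ⟪g, -((d / ‖g‖) • g)⟫ = -(‖g‖ * d) := by
    rw [inner_neg_right, inner_smul_right, real_inner_self_eq_norm_sq]
    field_simp
  have hnorm : ‖-((d / ‖g‖) • g)‖ = d := by
    rw [norm_neg, norm_smul, Real.norm_of_nonneg (by positivity)]
    field_simp
  have hquad : ⟪-((d / ‖g‖) • g), B (-((d / ‖g‖) • g))⟫ ≤ d * (‖B‖ * d) := by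
    have h₁ := real_inner_le_norm (-((d / ‖g‖) • g)) (B (-((d / ‖g‖) • g)))
    have h₂ := B.le_opNorm (-((d / ‖g‖) • g))
    rw [hnorm] at h₁ h₂
    exact h₁.trans (mul_le_mul_of_nonneg_left h₂ hd)
  have hmul : d * (1 + ‖B‖) ≤ ‖g‖ := (le_div_iff₀ (by positivity)).mp hdB
  have hBd : ‖B‖ * d ≤ ‖g‖ := by linarith
  have := mul_le_mul_of_nonneg_left hBd hd
  rw [hlin]
  linarith

/-- Sufficient Cauchy decrease: any step achieving a fraction `2κ_mdc` of the Cauchy-point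
decrease of the quadratic model `m(s) = gᵀs + (1/2)sᵀBs` within the trust region of radius
`r = ‖g‖^α/(1+‖B‖)^β · Δ` satisfies
`m(0) − m(s) ≥ κ_mdc ‖g‖ min{‖g‖/(1+‖B‖), r}`. -/
theorem cauchy_decrease {n : ℕ} (g : EuclideanSpace ℝ (Fin n)) (hg : g ≠ 0)
    (B : EuclideanSpace ℝ (Fin n) →L[ℝ] EuclideanSpace ℝ (Fin n))
    (hB : ∀ u v : EuclideanSpace ℝ (Fin n), ⟪B u, v⟫ = ⟪u, B v⟫)
    (Δ α β κm : ℝ) (hΔ : 0 < Δ) (hα : α ≤ 1) (hβ : β ≤ 1)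
    (hκm : 0 < κm) (hκm' : κm ≤ 1 / 2)
    (r : ℝ) (hr : r = ‖g‖ ^ α / (1 + ‖B‖) ^ β * Δ)
    (m : EuclideanSpace ℝ (Fin n) → ℝ)
    (hm : ∀ u : EuclideanSpace ℝ (Fin n), m u = ⟪g, u⟫ + 1 / 2 * ⟪u, B u⟫)
    (tstar : ℝ) (htmem : 0 ≤ tstar ∧ tstar * ‖g‖ ≤ r)
    (htmin : IsMinOn (fun u : ℝ => m (-(u • g))) {u : ℝ | 0 ≤ u ∧ u * ‖g‖ ≤ r} tstar)
    (scp : EuclideanSpace ℝ (Fin n)) (hscp : scp = -(tstar • g))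
    (s : EuclideanSpace ℝ (Fin n))
    (hs : m 0 - m s ≥ 2 * κm * (m 0 - m scp)) :
    m 0 - m s ≥ κm * ‖g‖ * min (‖g‖ / (1 + ‖B‖)) r := by
  have hN : 0 < ‖g‖ := norm_pos_iff.mpr hg
  have hb : 0 ≤ ‖B‖ := norm_nonneg B
  have hr0 : 0 ≤ r := by rw [hr]; positivity
  set d := min (‖g‖ / (1 + ‖B‖)) r with hd
  have hd0 : 0 ≤ d := le_min (by positivity) hr0
  have hmem : d / ‖g‖ ∈ {u : ℝ | 0 ≤ u ∧ u * ‖g‖ ≤ r} :=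
    ⟨by positivity, by rw [div_mul_cancel₀ _ hN.ne']; exact min_le_right _ _⟩
  have hmin : m scp ≤ m (-((d / ‖g‖) • g)) := hscp ▸ htmin hmem
  have hdec := half_norm_mul_le_steepest_descent_decrease hg B hd0 (min_le_left _ _)
  rw [← hm] at hdec
  have hm0 : m 0 = 0 := by simp [hm]
  have hcp : ‖g‖ * d / 2 ≤ m 0 - m scp := by linarith
  have := mul_le_mul_of_nonneg_left hcp (by positivity : 0 ≤ 2 * κm)
  linarith
end

section
/- Let f : ℝⁿ → ℝ be continuously differentiable with L-Lipschitz-continuous gradient (L > 0). Let x ∈ ℝⁿ, let B be a symmetric n×n real matrix, let g := ∇f(x), let Δ > 0, α ≤ 1, β ≤ 1, and set r := (‖g‖^α/(1+‖B‖)^β)·Δ and m(s) := f(x) + gᵀs + (1/2) sᵀ B s. Then for every s ∈ ℝⁿ with ‖s‖ ≤ r, one has |f(x + s) − m(s)| ≤ κ (1+‖B‖) (‖g‖^{2α}/(1+‖B‖)^{2β}) Δ², where κ := max{L, 1}/2. -/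
open scoped RealInnerProductSpace

/-- A differentiable function with `L`-Lipschitz gradient deviates from its first-order Taylor
expansion by at most `L / 2 * ‖s‖ ^ 2`. -/
theorem abs_sub_linearization_le_of_gradient_lipschitz {E : Type*} [NormedAddCommGroup E]
    [InnerProductSpace ℝ E] [CompleteSpace E] {f : E → ℝ} {L : ℝ} (hf : Differentiable ℝ f)
    (hlip : ∀ a b : E, ‖gradient f a - gradient f b‖ ≤ L * ‖a - b‖) (x s : E) :
    |f (x + s) - f x - ⟪gradient f x, s⟫| ≤ L / 2 * ‖s‖ ^ 2 := by
  have hderiv : ∀ t : ℝ, HasDerivAt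
      (fun t : ℝ => f (x + t • s) - f x - t * ⟪gradient f x, s⟫)
      (⟪gradient f (x + t • s) - gradient f x, s⟫) t := by
    intro t
    have hline : HasDerivAt (fun t : ℝ => x + t • s) s t := by
      simpa using ((hasDerivAt_id t).smul_const s).const_add x
    have hcomp := (hf (x + t • s)).hasGradientAt.hasFDerivAt.comp_hasDerivAt t hline
    have hlin := (hasDerivAt_id t).mul_const ⟪gradient f x, s⟫
    have h := (hcomp.sub_const (f x)).sub hlin
    rw [inner_sub_left]
    simpa [Function.comp_def] using! h
  have hquad : ∀ t : ℝ, HasDerivAt (fun t : ℝ => L / 2 * ‖s‖ ^ 2 * t ^ 2) (L * ‖s‖ ^ 2 * t) t := by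
    intro t
    refine ((hasDerivAt_pow 2 t).const_mul (L / 2 * ‖s‖ ^ 2)).congr_deriv ?_
    norm_num
    ring
  have key := image_norm_le_of_norm_deriv_right_le_deriv_boundary (a := 0) (b := 1)
    (fun t _ => (hderiv t).continuousAt.continuousWithinAt)
    (fun t _ => (hderiv t).hasDerivWithinAt) (by simp) hquad
    (fun t ht => by
      have h := hlip (x + t • s) x
      rw [add_sub_cancel_left, norm_smul, Real.norm_of_nonneg ht.1] at h
      calc ‖⟪gradient f (x + t • s) - gradient f x, s⟫‖
          ≤ ‖gradient f (x + t • s) - gradient f x‖ * ‖s‖ := norm_inner_le_norm _ _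
        _ ≤ L * (t * ‖s‖) * ‖s‖ := by gcongr
        _ = L * ‖s‖ ^ 2 * t := by ring)
  simpa using key (Set.right_mem_Icc.2 zero_le_one)

/-- Model error bound: for `f` with `L`-Lipschitz gradient, `g = ∇f(x)`,
`m(s) = f(x) + gᵀs + (1/2)sᵀBs`, and every `s` with `‖s‖ ≤ r = ‖g‖^α/(1+‖B‖)^β·Δ`,
`|f(x+s) − m(s)| ≤ κ (1+‖B‖) (‖g‖^{2α}/(1+‖B‖)^{2β}) Δ²` with `κ = max{L,1}/2`. -/
theorem model_error {n : ℕ} (f : EuclideanSpace ℝ (Fin n) → ℝ) (L : ℝ) (hL : 0 < L)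
    (hf : ContDiff ℝ 1 f)
    (hlip : ∀ a b : EuclideanSpace ℝ (Fin n), ‖gradient f a - gradient f b‖ ≤ L * ‖a - b‖)
    (x : EuclideanSpace ℝ (Fin n))
    (B : EuclideanSpace ℝ (Fin n) →L[ℝ] EuclideanSpace ℝ (Fin n))
    (hB : ∀ u v : EuclideanSpace ℝ (Fin n), ⟪B u, v⟫ = ⟪u, B v⟫)
    (g : EuclideanSpace ℝ (Fin n)) (hg : g = gradient f x)
    (Δ α β : ℝ) (hΔ : 0 < Δ) (hα : α ≤ 1) (hβ : β ≤ 1)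
    (r : ℝ) (hr : r = ‖g‖ ^ α / (1 + ‖B‖) ^ β * Δ)
    (m : EuclideanSpace ℝ (Fin n) → ℝ)
    (hm : ∀ u : EuclideanSpace ℝ (Fin n), m u = f x + ⟪g, u⟫ + 1 / 2 * ⟪u, B u⟫)
    (κ : ℝ) (hκ : κ = max L 1 / 2) :
    ∀ s : EuclideanSpace ℝ (Fin n), ‖s‖ ≤ r →
      |f (x + s) - m s| ≤ κ * (1 + ‖B‖) * (‖g‖ ^ (2 * α) / (1 + ‖B‖) ^ (2 * β)) * Δ ^ 2 := by
  intro s hs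
  have hlin := abs_sub_linearization_le_of_gradient_lipschitz
    (hf.differentiable one_ne_zero) hlip x s
  rw [← hg] at hlin
  have hquad : |⟪s, B s⟫| ≤ ‖B‖ * ‖s‖ ^ 2 := by
    calc |⟪s, B s⟫| ≤ ‖s‖ * ‖B s‖ := abs_real_inner_le_norm _ _
      _ ≤ ‖s‖ * (‖B‖ * ‖s‖) := by gcongr; exact B.le_opNorm s
      _ = ‖B‖ * ‖s‖ ^ 2 := by ring
  have hcoef : L / 2 + ‖B‖ / 2 ≤ κ * (1 + ‖B‖) := by
    rw [hκ]
    nlinarith [le_max_left L 1, le_max_right L 1, norm_nonneg B]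
  have hcoef_nonneg : 0 ≤ κ * (1 + ‖B‖) := by
    linarith [norm_nonneg B]
  have hsq : r ^ 2 = ‖g‖ ^ (2 * α) / (1 + ‖B‖) ^ (2 * β) * Δ ^ 2 := by
    rw [hr, mul_comm 2 α, mul_comm 2 β, Real.rpow_mul (norm_nonneg g),
      Real.rpow_mul (by positivity), Real.rpow_two, Real.rpow_two, mul_pow, div_pow]
  calc |f (x + s) - m s|
      = |(f (x + s) - f x - ⟪g, s⟫) - 1 / 2 * ⟪s, B s⟫| := by rw [hm]; congr 1; ring
    _ ≤ |f (x + s) - f x - ⟪g, s⟫| + |1 / 2 * ⟪s, B s⟫| := abs_sub _ _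
    _ = |f (x + s) - f x - ⟪g, s⟫| + 1 / 2 * |⟪s, B s⟫| := by rw [abs_mul]; norm_num
    _ ≤ (L / 2 + ‖B‖ / 2) * ‖s‖ ^ 2 := by linarith
    _ ≤ κ * (1 + ‖B‖) * r ^ 2 := by gcongr
    _ = κ * (1 + ‖B‖) * (‖g‖ ^ (2 * α) / (1 + ‖B‖) ^ (2 * β)) * Δ ^ 2 := by rw [hsq]; ring
end

section
/- Let μ > 0 and p > 0. For any natural numbers k₁ < k₂, one has Σ_{k=k₁}^{k₂} 1/(1 + μ(1 + (k+1)^p)) ≥ ((k₁+1)^p / (1 + μ(1 + (k₁+1)^p))) · ∫_{k₁+1}^{k₂+2} t^{−p} dt. -/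
open Finset in
theorem integral_rpow_neg_le_sum_Icc {p : ℝ} (hp : 0 ≤ p) {k₁ k₂ : ℕ} (hk : k₁ ≤ k₂) :
    ∫ t in ((k₁ : ℝ) + 1)..((k₂ : ℝ) + 2), t ^ (-p) ≤
      ∑ k ∈ Icc k₁ k₂, ((k : ℝ) + 1) ^ (-p) := by
  have hanti : AntitoneOn (fun t : ℝ ↦ t ^ (-p))
      (Set.Icc ((k₁ + 1 : ℕ) : ℝ) ((k₂ + 1 + 1 : ℕ) : ℝ)) := fun x hx y _ hxy ↦
    Real.rpow_le_rpow_of_nonpos (lt_of_lt_of_le (by positivity) hx.1) hxy (by linarith)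
  have h := hanti.integral_le_sum_Ico (by omega)
  rw [← sum_Ico_add' (fun k : ℕ ↦ (k : ℝ) ^ (-p)) k₁ (k₂ + 1) 1,
    Finset.Ico_add_one_right_eq_Icc] at h
  push_cast at h
  rwa [add_assoc (k₂ : ℝ), one_add_one_eq_two] at h

theorem div_mul_inv_le_one_div {μ a b : ℝ} (hμ : 0 ≤ μ) (ha : 0 < a) (hab : a ≤ b) :
    a / (1 + μ * (1 + a)) * b⁻¹ ≤ 1 / (1 + μ * (1 + b)) := by
  have hb : 0 < b := ha.trans_le hab
  rw [← div_eq_mul_inv, div_div, div_le_div_iff₀ (by positivity) (by positivity)]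
  nlinarith [mul_le_mul_of_nonneg_left hab hμ]

/-- For `μ > 0`, `p > 0` and naturals `k₁ < k₂`,
`Σ_{k=k₁}^{k₂} 1/(1 + μ(1 + (k+1)ᵖ)) ≥ ((k₁+1)ᵖ/(1 + μ(1 + (k₁+1)ᵖ))) ∫_{k₁+1}^{k₂+2} t⁻ᵖ dt`. -/
theorem sum_ge_integral (μ p : ℝ) (hμ : 0 < μ) (hp : 0 < p)
    (k₁ k₂ : ℕ) (hk : k₁ < k₂) :
    ∑ k ∈ Finset.Icc k₁ k₂, 1 / (1 + μ * (1 + ((k : ℝ) + 1) ^ p)) ≥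
      ((k₁ : ℝ) + 1) ^ p / (1 + μ * (1 + ((k₁ : ℝ) + 1) ^ p)) *
        ∫ t in ((k₁ : ℝ) + 1)..((k₂ : ℝ) + 2), t ^ (-p) := by
  calc
    _ ≤ ((k₁ : ℝ) + 1) ^ p / (1 + μ * (1 + ((k₁ : ℝ) + 1) ^ p)) *
        ∑ k ∈ Finset.Icc k₁ k₂, ((k : ℝ) + 1) ^ (-p) := by
      gcongr
      exact integral_rpow_neg_le_sum_Icc hp.le hk.le
    _ ≤ _ := by
      rw [Finset.mul_sum]
      refine Finset.sum_le_sum fun k hk ↦ ?_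
      have hk₁ : k₁ ≤ k := (Finset.mem_Icc.mp hk).1
      rw [Real.rpow_neg (by positivity)]
      exact div_mul_inv_le_one_div hμ.le (by positivity) (by gcongr)
end

section
/- Let 0 < ε < 1, c > 0, and p ∈ [0,1]. Set k_ε := ⌊ε^{−2/(1−p)}⌋ if 0 ≤ p < 1 and k_ε := ⌊exp(c ε^{−2})⌋ if p = 1. For k = 0,…,k_ε define ω_k := (k_ε − k)/k_ε and g_k := −ε(1 + ω_k); define B₀ := 1 and B_k := k^p for k ≥ 1; define s_k := −g_k/B_k for k = 0,…,k_ε−1; set f₀ := 8ε² + 4/(1−p) if 0 ≤ p < 1 and f₀ := 8ε² + 4c if p = 1, and f_{k+1} := f_k + g_k s_k for k = 0,…,k_ε−1. Then the sequence {f_k} is strictly decreasing, and f_k ∈ [0, f₀] for all k = 0,…,k_ε. -/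
/-- Bernoulli's inequality in increment form: an integer version of `∫_{n}^{n+1} x^(-p) dx`. -/
lemma one_div_rpow_le_sub_rpow_div {p : ℝ} (hp : 0 ≤ p) (hp1 : p < 1) (n : ℕ) :
    1 / ((n + 1 : ℕ) : ℝ) ^ p ≤
      ((n + 1 : ℕ) : ℝ) ^ (1 - p) / (1 - p) - (n : ℝ) ^ (1 - p) / (1 - p) := by
  have hq : 0 < 1 - p := by linarith
  have hx : (0 : ℝ) < ((n + 1 : ℕ) : ℝ) := by positivity
  have hn : (n : ℝ) = ((n + 1 : ℕ) : ℝ) - 1 := by push_cast; ring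
  have hx1 : (1 : ℝ) ≤ ((n + 1 : ℕ) : ℝ) := by simp
  rw [hn]
  generalize ((n + 1 : ℕ) : ℝ) = x at *
  have hx2 : 1 / x ≤ 1 := by rw [div_le_one hx]; exact hx1
  have bernoulli : (1 + -(1 / x)) ^ (1 - p) ≤ 1 + (1 - p) * -(1 / x) :=
    rpow_one_add_le_one_add_mul_self (by linarith) hq.le (by linarith)
  have hsplit : x - 1 = x * (1 + -(1 / x)) := by field_simp; ring
  have hrpow : x ^ (1 - p) * (1 / x) = 1 / x ^ p := by
    rw [Real.rpow_sub hx, Real.rpow_one]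
    field_simp
  rw [hsplit, Real.mul_rpow hx.le (by linarith), ← sub_div, le_div_iff₀ hq, ← hrpow]
  have := mul_le_mul_of_nonneg_left bernoulli (Real.rpow_nonneg hx.le (1 - p))
  linarith

lemma sum_one_div_rpow_le {p : ℝ} (hp : 0 ≤ p) (hp1 : p < 1) (n : ℕ) :
    ∑ i ∈ Finset.range n, 1 / ((i + 1 : ℕ) : ℝ) ^ p ≤ (n : ℝ) ^ (1 - p) / (1 - p) := by
  have hq : 1 - p ≠ 0 := by linarith
  calc ∑ i ∈ Finset.range n, 1 / ((i + 1 : ℕ) : ℝ) ^ p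
      ≤ ∑ i ∈ Finset.range n, (((i + 1 : ℕ) : ℝ) ^ (1 - p) / (1 - p)
          - (i : ℝ) ^ (1 - p) / (1 - p)) :=
        Finset.sum_le_sum fun i _ => one_div_rpow_le_sub_rpow_div hp hp1 i
    _ = (n : ℝ) ^ (1 - p) / (1 - p) := by
        rw [Finset.sum_range_sub fun i : ℕ => (i : ℝ) ^ (1 - p) / (1 - p)]
        simp [Real.zero_rpow hq]

lemma sum_one_div_le_one_add_log (n : ℕ) :
    ∑ i ∈ Finset.range n, 1 / ((i + 1 : ℕ) : ℝ) ≤ 1 + Real.log n := by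
  simpa [harmonic] using harmonic_le_one_add_log n

/-- Iterates that decrease by at most `a / B k` stay above a partial sum of `1 / B`. -/
lemma sub_mul_sum_le_of_step {a : ℝ} {K : ℕ} {B f : ℕ → ℝ} (hB0 : B 0 = 1)
    (hf : ∀ k < K, f k - a / B k ≤ f (k + 1)) (n : ℕ) (hn : n < K) :
    f 0 - a * (1 + ∑ i ∈ Finset.range n, 1 / B (i + 1)) ≤ f (n + 1) := by
  induction n with
  | zero => simpa [hB0] using hf 0 hn
  | succ n ih =>
    have h := ih (by omega)
    have h' := hf (n + 1) hn
    rw [Finset.sum_range_succ]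
    rw [div_eq_mul_one_div] at h'
    linarith

/-- The accumulated decrease over at most `⌊ε^(-2/(1-p))⌋` steps, for `p < 1`. -/
lemma sq_mul_sum_le_of_lt_one {ε p : ℝ} (hε : 0 < ε) (hp : 0 ≤ p) (hp1 : p < 1) {n : ℕ}
    (hn : n ≤ ⌊ε ^ (-2 / (1 - p))⌋₊) :
    ε ^ 2 * ∑ i ∈ Finset.range n, 1 / ((i + 1 : ℕ) : ℝ) ^ p ≤ 1 / (1 - p) := by
  have hq : 0 < 1 - p := by linarith
  have hn' : (n : ℝ) ≤ ε ^ (-2 / (1 - p)) :=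
    (Nat.cast_le.mpr hn).trans (Nat.floor_le (by positivity))
  have hpow : (n : ℝ) ^ (1 - p) ≤ (ε ^ 2)⁻¹ := by
    calc (n : ℝ) ^ (1 - p) ≤ (ε ^ (-2 / (1 - p))) ^ (1 - p) :=
          Real.rpow_le_rpow n.cast_nonneg hn' hq.le
      _ = (ε ^ 2)⁻¹ := by
          rw [← Real.rpow_mul hε.le, div_mul_cancel₀ _ hq.ne', Real.rpow_neg hε.le,
            Real.rpow_two]
  calc ε ^ 2 * ∑ i ∈ Finset.range n, 1 / ((i + 1 : ℕ) : ℝ) ^ p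
      ≤ ε ^ 2 * ((ε ^ 2)⁻¹ / (1 - p)) := by
        gcongr
        exact (sum_one_div_rpow_le hp hp1 n).trans (by gcongr)
    _ = 1 / (1 - p) := by field_simp

/-- The accumulated decrease over at most `⌊exp (c ε⁻²)⌋` steps, for `p = 1`. -/
lemma sq_mul_sum_le_of_eq_one {ε c : ℝ} (hε : 0 < ε) (hc : 0 < c) {n : ℕ}
    (hn : n ≤ ⌊Real.exp (c * ε ^ (-2 : ℝ))⌋₊) :
    ε ^ 2 * ∑ i ∈ Finset.range n, 1 / ((i + 1 : ℕ) : ℝ) ≤ ε ^ 2 + c := by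
  have hrpow : ε ^ (-2 : ℝ) = (ε ^ 2)⁻¹ := by rw [Real.rpow_neg hε.le, Real.rpow_two]
  have hlog : Real.log n ≤ c * (ε ^ 2)⁻¹ := by
    rcases n.eq_zero_or_pos with rfl | hpos
    · simp only [Nat.cast_zero, Real.log_zero]
      positivity
    · rw [← hrpow, Real.log_le_iff_le_exp (by exact_mod_cast hpos)]
      exact (Nat.cast_le.mpr hn).trans (Nat.floor_le (Real.exp_pos _).le)
  calc ε ^ 2 * ∑ i ∈ Finset.range n, 1 / ((i + 1 : ℕ) : ℝ)
      ≤ ε ^ 2 * (1 + c * (ε ^ 2)⁻¹) := by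
        gcongr
        exact (sum_one_div_le_one_add_log n).trans (by gcongr)
    _ = ε ^ 2 + c := by field_simp


open Classical in
/-- Properties of the objective values in the slow-convergence construction:
with `ω_k = (k_ε−k)/k_ε`, `g_k = −ε(1+ω_k)`, `B₀ = 1`, `B_k = kᵖ` (`k ≥ 1`),
`s_k = −g_k/B_k`, `f₀ = 8ε² + 4/(1−p)` (or `8ε² + 4c` if `p = 1`) and
`f_{k+1} = f_k + g_k s_k`, the sequence `{f_k}` is decreasing and `f_k ∈ [0, f₀]`
for `k = 0,…,k_ε`. -/
theorem slow_example_objective (ε c p : ℝ) (hε : 0 < ε) (hε1 : ε < 1) (hc : 0 < c)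
    (hp : 0 ≤ p) (hp1 : p ≤ 1)
    (kε : ℕ)
    (hkε : kε = if p = 1 then ⌊Real.exp (c * ε ^ (-2 : ℝ))⌋₊ else ⌊ε ^ (-2 / (1 - p))⌋₊)
    (ω g B s f : ℕ → ℝ)
    (hω : ∀ k, ω k = ((kε : ℝ) - (k : ℝ)) / (kε : ℝ))
    (hg : ∀ k, g k = -ε * (1 + ω k))
    (hB0 : B 0 = 1) (hBk : ∀ k : ℕ, 1 ≤ k → B k = (k : ℝ) ^ p)
    (hs : ∀ k, s k = -g k / B k)
    (hf0 : f 0 = if p = 1 then 8 * ε ^ 2 + 4 * c else 8 * ε ^ 2 + 4 / (1 - p))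
    (hf : ∀ k, f (k + 1) = f k + g k * s k) :
    (∀ k < kε, f (k + 1) < f k) ∧ ∀ k ≤ kε, f k ∈ Set.Icc 0 (f 0) := by
  have hBpos : ∀ k, 0 < B k := by
    rintro (_ | k)
    · simp [hB0]
    · rw [hBk _ k.succ_pos]
      positivity
  have hstep : ∀ k, f (k + 1) = f k - g k ^ 2 / B k := by
    intro k
    rw [hf, hs]
    ring
  have hanti : Antitone f := antitone_nat_of_succ_le fun k => by
    have := div_nonneg (sq_nonneg (g k)) (hBpos k).le
    linarith [hstep k]
  have hωmem : ∀ k < kε, 0 ≤ ω k ∧ ω k ≤ 1 := by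
    intro k hk
    have hk' : (k : ℝ) < kε := by exact_mod_cast hk
    have hk0 : (0 : ℝ) ≤ k := k.cast_nonneg
    rw [hω]
    exact ⟨div_nonneg (by linarith) (by linarith), div_le_one_of_le₀ (by linarith) (by linarith)⟩
  have hdec : ∀ k < kε, f k - 4 * ε ^ 2 / B k ≤ f (k + 1) := by
    intro k hk
    obtain ⟨h0, h1⟩ := hωmem k hk
    have hg2 : g k ^ 2 ≤ 4 * ε ^ 2 := by
      rw [hg, show (-ε * (1 + ω k)) ^ 2 = (1 + ω k) ^ 2 * ε ^ 2 by ring]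
      gcongr
      nlinarith
    rw [hstep]
    have := div_le_div_of_nonneg_right hg2 (hBpos k).le
    linarith
  refine ⟨fun k hk => ?_, fun k hk => ⟨?_, hanti k.zero_le⟩⟩
  · have hg0 : g k ≠ 0 := by
      rw [hg]
      exact mul_ne_zero (neg_ne_zero.mpr hε.ne') (by linarith [(hωmem k hk).1])
    have hpos : 0 < g k ^ 2 / B k := div_pos (by positivity) (hBpos k)
    linarith [hstep k]
  · rcases k with _ | n
    · rw [hf0]
      split_ifs
      · positivity
      · have : 0 ≤ 1 - p := by linarith
        positivity
    · have hlow := sub_mul_sum_le_of_step hB0 hdec n hk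
      have hsum : ∑ i ∈ Finset.range n, 1 / B (i + 1) =
          ∑ i ∈ Finset.range n, 1 / ((i + 1 : ℕ) : ℝ) ^ p :=
        Finset.sum_congr rfl fun i _ => by rw [hBk _ i.succ_pos]
      rw [hsum, hf0] at hlow
      split_ifs at hkε hlow with h
      · subst h
        have := sq_mul_sum_le_of_eq_one hε hc (n := n) (by omega)
        simp only [Real.rpow_one] at hlow
        linarith
      · have := sq_mul_sum_le_of_lt_one hε hp (lt_of_le_of_ne hp1 h) (n := n) (by omega)
        rw [div_eq_mul_one_div] at hlow
        nlinarith [sq_nonneg ε]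
end
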